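/- For 2 ≤ k ≤ n, the function f = σ_k^{1/k} on the Garding cone Γ_k = {λ ∈ ℝⁿ : σ_j(λ) > 0 for all 1 ≤ j ≤ k} satisfies: f is homogeneous of degree 1, f_i > 0 on Γ_k, f is concave on Γ_k, and for every σ > 0 and λ ∈ Γ_k with f(λ) > σ, the set {μ ∈ Γ_k : f(μ) = σ} ∩ T_λ is nonempty and compact, where T_λ is the tangent plane at λ to the level set {f = f(λ)}. -/

import Mathlib

noncomputable section

/-- The `k`-th elementary symmetric function `σ_k`. -/
def esymmFun (n k : ℕ) (x : EuclideanSpace ℝ (Fin n)) : ℝ :=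
  ∑ s ∈ (Finset.univ : Finset (Fin n)).powersetCard k, ∏ i ∈ s, x i

/-- The Garding cone `Γ_k = {λ : σ_j(λ) > 0 for all 1 ≤ j ≤ k}`. -/
def gardingCone (n k : ℕ) : Set (EuclideanSpace ℝ (Fin n)) :=
  {x | ∀ j : ℕ, 1 ≤ j → j ≤ k → 0 < esymmFun n j x}

/-- `f = σ_k^{1/k}`. -/
def sigmaRoot (n k : ℕ) (x : EuclideanSpace ℝ (Fin n)) : ℝ :=
  esymmFun n k x ^ ((1 : ℝ) / k)


set_option linter.unusedSectionVars false
namespace SK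
variable {ι : Type*} [DecidableEq ι]

noncomputable def E (s : Finset ι) (k : ℕ) (x : ι → ℝ) : ℝ :=
  ∑ t ∈ s.powersetCard k, ∏ i ∈ t, x i

theorem E_zero (s : Finset ι) (x : ι → ℝ) : E s 0 x = 1 := by simp [E]

theorem E_insert {s : Finset ι} {a : ι} (ha : a ∉ s) (k : ℕ) (x : ι → ℝ) :
    E (insert a s) (k+1) x = x a * E s k x + E s (k+1) x := by
  unfold E
  rw [Finset.powersetCard_succ_insert ha, Finset.sum_union, Finset.sum_image, add_comm]
  · congr 1
    rw [Finset.mul_sum]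
    refine Finset.sum_congr rfl fun t ht => ?_
    rw [Finset.prod_insert]
    intro h
    exact ha ((Finset.mem_powersetCard.1 ht).1 h)
  · intro t ht u hu h
    have h1 : a ∉ t := fun h => ha ((Finset.mem_powersetCard.1 ht).1 h)
    have h2 : a ∉ u := fun h => ha ((Finset.mem_powersetCard.1 hu).1 h)
    rw [← Finset.erase_insert h1, ← Finset.erase_insert h2, h]
  · rw [Finset.disjoint_left]
    intro t ht h
    obtain ⟨u, hu, rfl⟩ := Finset.mem_image.1 h
    exact ha ((Finset.mem_powersetCard.1 ht).1 (Finset.mem_insert_self _ _))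

theorem E_rec {s : Finset ι} {a : ι} (ha : a ∈ s) (k : ℕ) (x : ι → ℝ) :
    E s (k+1) x = x a * E (s.erase a) k x + E (s.erase a) (k+1) x := by
  rw [← E_insert (Finset.notMem_erase a s), Finset.insert_erase ha]

theorem E_sum (s : Finset ι) (k : ℕ) (x : ι → ℝ) :
    ∑ i ∈ s, x i * E (s.erase i) k x = (k+1) * E s (k+1) x := by
  induction s using Finset.induction_on generalizing k with
  | empty =>
    have : Finset.powersetCard (k+1) (∅ : Finset ι) = ∅ :=
      Finset.powersetCard_eq_empty.2 (by simp)
    simp [E, this]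
  | insert a s ha ih =>
    rw [Finset.sum_insert ha, Finset.erase_insert ha, E_insert ha]
    have key : ∀ i ∈ s, (insert a s).erase i = insert a (s.erase i) := by
      intro i hi
      rw [Finset.erase_insert_of_ne]
      rintro rfl; exact ha hi
    have na : ∀ i ∈ s, a ∉ s.erase i := fun i _ h => ha (Finset.mem_of_mem_erase h)
    cases k with
    | zero =>
      have := ih 0
      simp only [E_zero] at this ⊢
      rw [this]; push_cast; ring
    | succ k =>
      have : ∑ i ∈ s, x i * E ((insert a s).erase i) (k+1) x
          = x a * ∑ i ∈ s, x i * E (s.erase i) k x + ∑ i ∈ s, x i * E (s.erase i) (k+1) x := by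
        rw [Finset.mul_sum, ← Finset.sum_add_distrib]
        refine Finset.sum_congr rfl fun i hi => ?_
        rw [key i hi, E_insert (na i hi)]; ring
      rw [this, ih, ih]; push_cast; ring

theorem newton (k : ℕ) : ∀ (s : Finset ι) (x : ι → ℝ),
    E s k x * E s (k+2) x ≤ E s (k+1) x ^ 2 := by
  have main : ∀ (k : ℕ) (s : Finset ι) (x : ι → ℝ),
      (∀ i ∈ s, 0 ≤ x i * E (s.erase i) k x * E s (k+1) x
        - x i * E (s.erase i) (k+1) x * E s k x) →
      E s k x * E s (k+2) x ≤ E s (k+1) x ^ 2 := by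
    intro k s x h
    have h1 := Finset.sum_nonneg h
    rw [Finset.sum_sub_distrib, ← Finset.sum_mul, ← Finset.sum_mul, E_sum, E_sum] at h1
    push_cast at h1
    have : (0:ℝ) ≤ k := k.cast_nonneg
    have h3 : ((k:ℝ)+2) * (E s k x * E s (k+2) x) ≤ (k+2) * E s (k+1) x ^ 2 := by
      have : k + 1 + 1 = k + 2 := rfl
      rw [this] at h1
      nlinarith [sq_nonneg (E s (k+1) x)]
    exact le_of_mul_le_mul_left h3 (by positivity)
  induction k with
  | zero =>
    intro s x
    refine main 0 s x fun i hi => ?_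
    rw [E_rec hi]
    simp only [E_zero]
    nlinarith [sq_nonneg (x i)]
  | succ k ih =>
    intro s x
    refine main (k+1) s x fun i hi => ?_
    rw [E_rec hi (k+1), E_rec hi k]
    have := mul_nonneg (sq_nonneg (x i)) (sub_nonneg.2 (ih (s.erase i) x))
    nlinarith

def G (s : Finset ι) (k : ℕ) (x : ι → ℝ) : Prop := ∀ j ≤ k, 0 < E s j x

theorem G.mono {s : Finset ι} {k l : ℕ} {x : ι → ℝ} (h : G s k x) (hl : l ≤ k) : G s l x :=
  fun j hj => h j (hj.trans hl)

theorem G_zero (s : Finset ι) (x : ι → ℝ) : G s 0 x := by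
  intro j hj
  obtain rfl : j = 0 := by omega
  rw [E_zero]; exact one_pos

theorem G_succ {s : Finset ι} {k : ℕ} {x : ι → ℝ} (h : G s k x) (h' : 0 < E s (k+1) x) :
    G s (k+1) x := by
  intro j hj
  rcases Nat.lt_or_ge k j with h1 | h1
  · obtain rfl : j = k+1 := by omega
    exact h'
  · exact h j h1

theorem G_erase (k : ℕ) : ∀ (s : Finset ι) (x : ι → ℝ) (i : ι), i ∈ s → G s (k+1) x →
    G (s.erase i) k x := by
  induction k with
  | zero => intro s x i _ _; exact G_zero _ _
  | succ k ih =>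
    intro s x i hi h
    have h0 := ih s x i hi (h.mono (by omega))
    refine G_succ h0 ?_
    by_contra hc
    push Not at hc
    have a := h0 k le_rfl
    have b := h (k+1) (by omega)
    have c := h (k+2) (by omega)
    rw [E_rec hi] at b c
    have d := newton k (s.erase i) x
    set p := E (s.erase i) k x
    set q := E (s.erase i) (k+1) x
    set r := E (s.erase i) (k+2) x
    have e1 : 0 < p * (x i * q + r) := mul_pos a c
    have e2 : 0 ≤ (x i * p + q) * (-q) := mul_nonneg b.le (by linarith)
    nlinarith

theorem sq_div_superadd {x y z w v : ℝ} (hz : 0 < z) (hw : 0 < w) (hv : z + w ≤ v) :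
    (x+y)^2 / v ≤ x^2/z + y^2/w := by
  have : (x+y)^2/v ≤ (x+y)^2/(z+w) := by gcongr
  refine this.trans ?_
  rw [div_add_div _ _ hz.ne' hw.ne', div_le_div_iff₀ (by positivity) (by positivity)]
  nlinarith [sq_nonneg (x*w - y*z), mul_pos hz hw]

theorem phi_formula {s : Finset ι} {k : ℕ} {x : ι → ℝ} (h : G s (k+1) x) :
    ((k:ℝ)+2) * (E s (k+2) x / E s (k+1) x) =
      ∑ i ∈ s, (x i - x i ^2 / (x i + E (s.erase i) (k+1) x / E (s.erase i) k x)) := by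
  have h1 := E_sum s (k+1) x
  have h2 : ((k:ℝ)+2) * (E s (k+2) x / E s (k+1) x)
      = (∑ i ∈ s, x i * E (s.erase i) (k+1) x) / E s (k+1) x := by
    rw [h1]; push_cast; ring
  rw [h2, Finset.sum_div]
  refine Finset.sum_congr rfl fun i hi => ?_
  have a := G_erase k s x i hi h k le_rfl
  have b := h (k+1) le_rfl
  rw [E_rec hi] at b ⊢
  have c : x i + E (s.erase i) (k+1) x / E (s.erase i) k x
      = (x i * E (s.erase i) k x + E (s.erase i) (k+1) x) / E (s.erase i) k x := by
    field_simp
  rw [c]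
  field_simp
  ring

theorem superadd (k : ℕ) : ∀ (s : Finset ι) (x y : ι → ℝ), G s k x → G s k y →
    G s k (x+y) ∧ E s (k+1) x / E s k x + E s (k+1) y / E s k y
      ≤ E s (k+1) (x+y) / E s k (x+y) := by
  induction k with
  | zero =>
    intro s x y _ _
    refine ⟨G_zero _ _, ?_⟩
    have h := fun x : ι → ℝ => E_sum s 0 x
    simp only [E_zero] at h ⊢
    have h1 := h x
    have h2 := h y
    have h3 := h (x+y)
    simp only [Pi.add_apply, mul_one, Finset.sum_add_distrib] at h1 h2 h3
    norm_num at h1 h2 h3 ⊢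
    linarith
  | succ k ih =>
    intro s x y hx hy
    have ⟨g0, g1⟩ := ih s x y (hx.mono (by omega)) (hy.mono (by omega))
    have g : G s (k+1) (x+y) := by
      refine G_succ g0 ?_
      have := add_pos (div_pos (hx (k+1) le_rfl) (hx k (by omega)))
        (div_pos (hy (k+1) le_rfl) (hy k (by omega)))
      exact (div_pos_iff_of_pos_right (g0 k le_rfl)).1 (this.trans_le g1)
    refine ⟨g, ?_⟩
    have hp : (0:ℝ) < (k:ℝ)+2 := by positivity
    refine le_of_mul_le_mul_left ?_ hp
    rw [mul_add]
    have e : k + 1 + 1 = k + 2 := rfl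
    rw [e, phi_formula hx, phi_formula hy, phi_formula g, ← Finset.sum_add_distrib]
    refine Finset.sum_le_sum fun i hi => ?_
    have zpos : ∀ {x : ι → ℝ}, G s (k+1) x →
        0 < x i + E (s.erase i) (k+1) x / E (s.erase i) k x := by
      intro x hx
      have a := G_erase k s x i hi hx k le_rfl
      have b := hx (k+1) le_rfl
      rw [E_rec hi] at b
      have c : x i + E (s.erase i) (k+1) x / E (s.erase i) k x
        = (x i * E (s.erase i) k x + E (s.erase i) (k+1) x) / E (s.erase i) k x := by
        field_simp
      rw [c]; positivity
    have i1 := (ih (s.erase i) x y (G_erase k s x i hi hx) (G_erase k s y i hi hy)).2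
    have := sq_div_superadd (x := x i) (y := y i) (zpos hx) (zpos hy)
      (v := (x+y) i + E (s.erase i) (k+1) (x+y) / E (s.erase i) k (x+y)) (by
        simp only [Pi.add_apply] ; linarith)
    simp only [Pi.add_apply] at this ⊢
    linarith

theorem E_smul (s : Finset ι) (k : ℕ) (t : ℝ) (x : ι → ℝ) : E s k (t • x) = t^k * E s k x := by
  unfold E
  rw [Finset.mul_sum]
  refine Finset.sum_congr rfl fun u hu => ?_
  simp [Finset.prod_mul_distrib, (Finset.mem_powersetCard.1 hu).2]

theorem E_prod {s : Finset ι} {k : ℕ} {x : ι → ℝ} (h : G s k x) :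
    ∏ j ∈ Finset.range k, (E s (j+1) x / E s j x) = E s k x := by
  induction k with
  | zero => simp [E_zero]
  | succ k ih =>
    rw [Finset.prod_range_succ, ih (h.mono (by omega))]
    have := h k (by omega)
    field_simp

theorem G_add {s : Finset ι} {k : ℕ} {x y : ι → ℝ} (hx : G s k x) (hy : G s k y) : G s k (x+y) :=
  (superadd k s x y hx hy).1

theorem G_smul {s : Finset ι} {k : ℕ} {x : ι → ℝ} (hx : G s k x) {t : ℝ} (ht : 0 < t) :
    G s k (t • x) := by
  intro j hj
  rw [E_smul]
  have := hx j hj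
  positivity

/-- Minkowski inequality for geometric means. -/
theorem geom_superadd (k : ℕ) (hk : 0 < k) (a b c : ℕ → ℝ)
    (ha : ∀ j ∈ Finset.range k, 0 < a j) (hb : ∀ j ∈ Finset.range k, 0 < b j)
    (hc : ∀ j ∈ Finset.range k, a j + b j ≤ c j) :
    (∏ j ∈ Finset.range k, a j) ^ ((1:ℝ)/k) + (∏ j ∈ Finset.range k, b j) ^ ((1:ℝ)/k)
      ≤ (∏ j ∈ Finset.range k, c j) ^ ((1:ℝ)/k) := by
  have hk' : (0:ℝ) < k := by exact_mod_cast hk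
  have hcp : ∀ j ∈ Finset.range k, 0 < c j := fun j hj => by
    linarith [ha j hj, hb j hj, hc j hj]
  have hC : 0 < (∏ j ∈ Finset.range k, c j) ^ ((1:ℝ)/k) :=
    Real.rpow_pos_of_pos (Finset.prod_pos hcp) _
  have amgm : ∀ a : ℕ → ℝ, (∀ j ∈ Finset.range k, 0 < a j) →
      (∏ j ∈ Finset.range k, a j) ^ ((1:ℝ)/k) / (∏ j ∈ Finset.range k, c j) ^ ((1:ℝ)/k)
        ≤ ∑ j ∈ Finset.range k, (1/k:ℝ) * (a j / c j) := by
    intro a ha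
    have := Real.geom_mean_le_arith_mean_weighted (Finset.range k) (fun _ => (1/k:ℝ))
      (fun j => a j / c j) (fun _ _ => by positivity) (by simp [hk'.ne'])
      (fun j hj => (div_pos (ha j hj) (hcp j hj)).le)
    rw [Real.finsetProd_rpow _ _ (fun j hj => (div_pos (ha j hj) (hcp j hj)).le),
      Finset.prod_div_distrib, Real.div_rpow (Finset.prod_pos ha).le (Finset.prod_pos hcp).le] at this
    exact this
  have h1 := amgm a ha
  have h2 := amgm b hb
  have h3 : ∑ j ∈ Finset.range k, (1/k:ℝ) * (a j / c j)
      + ∑ j ∈ Finset.range k, (1/k:ℝ) * (b j / c j) ≤ 1 := by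
    rw [← Finset.sum_add_distrib]
    calc _ ≤ ∑ j ∈ Finset.range k, (1/k:ℝ) := by
          refine Finset.sum_le_sum fun j hj => ?_
          rw [← mul_add, ← add_div]
          have : (a j + b j) / c j ≤ 1 := (div_le_one (hcp j hj)).2 (hc j hj)
          exact mul_le_of_le_one_right (by positivity) this
      _ = 1 := by simp [hk'.ne']
  have h4 := (add_le_add h1 h2).trans h3
  rw [← add_div, div_le_one hC] at h4
  exact h4

theorem root_superadd {s : Finset ι} {k : ℕ} (hk : 0 < k) {x y : ι → ℝ}
    (hx : G s k x) (hy : G s k y) :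
    E s k x ^ ((1:ℝ)/k) + E s k y ^ ((1:ℝ)/k) ≤ E s k (x+y) ^ ((1:ℝ)/k) := by
  rw [← E_prod hx, ← E_prod hy, ← E_prod (G_add hx hy)]
  refine geom_superadd k hk _ _ _ ?_ ?_ ?_
  · intro j hj; have := Finset.mem_range.1 hj
    exact div_pos (hx _ (by omega)) (hx _ (by omega))
  · intro j hj; have := Finset.mem_range.1 hj
    exact div_pos (hy _ (by omega)) (hy _ (by omega))
  · intro j hj; have := Finset.mem_range.1 hj
    exact (superadd j s x y (hx.mono (by omega)) (hy.mono (by omega))).2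

theorem E_add_lower {s : Finset ι} {k : ℕ} {x y : ι → ℝ} (hx : G s (k+1) x) (hy : G s (k+1) y) :
    E s (k+1) x * (1 + E s 1 y / E s 1 x) ≤ E s (k+1) (x+y) := by
  rw [← E_prod hx, ← E_prod (G_add hx hy), Finset.prod_range_succ', Finset.prod_range_succ' (n := k)]
  have p1 := hx 1 (by omega)
  have pos : ∀ {z : ι → ℝ}, G s (k+1) z → ∀ j ∈ Finset.range k,
    0 < E s (j+1+1) z / E s (j+1) z := by
    intro z hz j hj; have := Finset.mem_range.1 hj
    exact div_pos (hz _ (by omega)) (hz _ (by omega))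
  have h0 := (superadd 0 s x y (G_zero _ _) (G_zero _ _)).2
  simp only [E_zero, zero_add, div_one] at h0 ⊢
  rw [mul_assoc]
  have : E s 1 x * (1 + E s 1 y / E s 1 x) = E s 1 x + E s 1 y := by field_simp
  rw [this]
  refine mul_le_mul ?_ h0 (add_pos p1 (hy 1 (by omega))).le (Finset.prod_pos (pos (G_add hx hy))).le
  refine Finset.prod_le_prod (fun j hj => (pos hx j hj).le) fun j hj => ?_
  have hj' := Finset.mem_range.1 hj
  have := (superadd (j+1) s x y (hx.mono (by omega)) (hy.mono (by omega))).2
  linarith [pos hy j hj]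

theorem E_le_mul {s : Finset ι} {x : ι → ℝ} (j : ℕ) (hx : G s j x) :
    E s (j+1) x ≤ E s j x * E s 1 x := by
  induction j with
  | zero => simp [E_zero]
  | succ j ih =>
    have h1 := ih (hx.mono (by omega))
    have h2 := newton j s x
    have p := hx j (by omega)
    have q := hx (j+1) (by omega)
    refine le_of_mul_le_mul_left ?_ p
    calc _ ≤ _ := h2
      _ ≤ E s (j+1) x * (E s j x * E s 1 x) := by rw [sq]; gcongr
      _ = _ := by ring

theorem sum_sq_le {s : Finset ι} {x : ι → ℝ} (hx : G s 2 x) : ∑ i ∈ s, x i ^ 2 ≤ E s 1 x ^ 2 := by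
  have h0 := E_sum s 0 x
  have h1 := E_sum s 1 x
  simp only [E_zero] at h0
  have : ∀ i ∈ s, x i * E (s.erase i) 1 x = x i * E s 1 x - x i ^ 2 := by
    intro i hi; rw [E_rec hi 0, E_zero]; ring
  rw [Finset.sum_congr rfl this, Finset.sum_sub_distrib, ← Finset.sum_mul] at h1
  have := hx 2 le_rfl
  norm_num at h0 h1
  rw [h0] at h1
  nlinarith
end SK

theorem mem_cone {n k : ℕ} {x : EuclideanSpace ℝ (Fin n)} :
    x ∈ gardingCone n k ↔ SK.G Finset.univ k x.ofLp := by
  constructor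
  · intro h j hj
    rcases Nat.eq_zero_or_pos j with rfl | h0
    · rw [SK.E_zero]; exact one_pos
    · exact h j h0 hj
  · intro h j _ hj
    exact h j hj

theorem esymm_contDiff (n k : ℕ) : ContDiff ℝ 1 (esymmFun n k) := by
  unfold esymmFun
  fun_prop

theorem esymm_cont (n k : ℕ) : Continuous (esymmFun n k) := (esymm_contDiff n k).continuous

theorem cone_open (n k : ℕ) : IsOpen (gardingCone n k) := by
  have : gardingCone n k = ⋂ j ∈ Finset.Icc 1 k, {x | 0 < esymmFun n j x} := by
    ext x; simp [gardingCone]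
  rw [this]
  exact isOpen_biInter_finset fun j _ => isOpen_lt continuous_const (esymm_cont n j)

/-- The derivative of the root is a positive multiple of that of `σ_k`. -/
theorem root_fderiv {n k : ℕ} (hk : 1 ≤ k) {x : EuclideanSpace ℝ (Fin n)} (hx : x ∈ gardingCone n k) :
    ∃ a : ℝ, 0 < a ∧ fderiv ℝ (sigmaRoot n k) x = a • fderiv ℝ (esymmFun n k) x := by
  have hp : 0 < esymmFun n k x := hx k hk le_rfl
  have hd : HasFDerivAt (esymmFun n k) (fderiv ℝ (esymmFun n k) x) x :=
    ((esymm_contDiff n k).differentiable one_ne_zero x).hasFDerivAt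
  have := hd.rpow_const (p := (1:ℝ)/k) (Or.inl hp.ne')
  refine ⟨_, ?_, this.fderiv⟩
  have hk' : (0:ℝ) < k := by exact_mod_cast hk
  positivity

theorem line_deriv {n k : ℕ} (x v : EuclideanSpace ℝ (Fin n)) :
    HasDerivAt (fun t : ℝ => esymmFun n k (x + t • v)) (fderiv ℝ (esymmFun n k) x v) 0 := by
  have hd : HasFDerivAt (esymmFun n k) (fderiv ℝ (esymmFun n k) x) x :=
    ((esymm_contDiff n k).differentiable one_ne_zero x).hasFDerivAt
  exact hd.hasLineDerivAt v

theorem partial_pos {n k : ℕ} (hk : 1 ≤ k) {x : EuclideanSpace ℝ (Fin n)}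
    (hx : x ∈ gardingCone n k) (i : Fin n) :
    0 < fderiv ℝ (esymmFun n k) x (EuclideanSpace.single i 1) := by
  obtain ⟨k, rfl⟩ : ∃ m, k = m + 1 := ⟨k-1, by omega⟩
  have h1 := line_deriv (k := k+1) x (EuclideanSpace.single i 1)
  have h2 : (fun t : ℝ => esymmFun n (k+1) (x + t • EuclideanSpace.single i 1)) =
      fun t : ℝ => esymmFun n (k+1) x + t * SK.E (Finset.univ.erase i) k x.ofLp := by
    funext t
    change SK.E Finset.univ (k+1) _ = SK.E Finset.univ (k+1) _ + _
    rw [SK.E_rec (Finset.mem_univ i), SK.E_rec (Finset.mem_univ i)]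
    have hE : ∀ j, SK.E (Finset.univ.erase i) j (x + t • EuclideanSpace.single i (1:ℝ)).ofLp
        = SK.E (Finset.univ.erase i) j x.ofLp := by
      intro j
      refine Finset.sum_congr rfl fun u hu => Finset.prod_congr rfl fun l hl => ?_
      have : l ≠ i := Finset.ne_of_mem_erase ((Finset.mem_powersetCard.1 hu).1 hl)
      simp [this]
    rw [hE, hE]
    simp
    ring
  rw [h2] at h1
  have h3 : HasDerivAt (fun t : ℝ => esymmFun n (k+1) x
      + t * SK.E (Finset.univ.erase i) k x.ofLp) (SK.E (Finset.univ.erase i) k x.ofLp) 0 := by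
    simpa using ((hasDerivAt_id (0:ℝ)).mul_const
      (SK.E (Finset.univ.erase i) k x.ofLp)).const_add (esymmFun n (k+1) x)
  rw [h1.unique h3]
  exact SK.G_erase k _ _ i (Finset.mem_univ i) (mem_cone.1 hx) k le_rfl

theorem fderiv_lower {n k : ℕ} (hk : 1 ≤ k) {x y : EuclideanSpace ℝ (Fin n)}
    (hx : x ∈ gardingCone n k) (hy : y ∈ gardingCone n k) :
    esymmFun n k x / esymmFun n 1 x * esymmFun n 1 y ≤ fderiv ℝ (esymmFun n k) x y := by
  obtain ⟨k, rfl⟩ : ∃ m, k = m + 1 := ⟨k-1, by omega⟩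
  have h1 := (line_deriv (k := k+1) x y).tendsto_slope_zero_right
  refine ge_of_tendsto h1 ?_
  filter_upwards [self_mem_nhdsWithin] with t ht
  have ht : 0 < t := ht
  have h2 := SK.E_add_lower (mem_cone.1 hx) (SK.G_smul (mem_cone.1 hy) ht)
  rw [SK.E_smul] at h2
  simp only [zero_add, zero_smul, add_zero, smul_eq_mul]
  change esymmFun n (k+1) x * (1 + t^1 * esymmFun n 1 y / esymmFun n 1 x)
    ≤ esymmFun n (k+1) (x + t • y) at h2
  rw [inv_mul_eq_div, le_div_iff₀ ht]
  have : esymmFun n (k+1) x * (1 + t^1 * esymmFun n 1 y / esymmFun n 1 x)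
    = esymmFun n (k+1) x + esymmFun n (k+1) x / esymmFun n 1 x * esymmFun n 1 y * t := by ring
  linarith

theorem norm_le_sigma {n k : ℕ} (hk : 2 ≤ k) {x : EuclideanSpace ℝ (Fin n)}
    (hx : x ∈ gardingCone n k) : ‖x‖ ≤ esymmFun n 1 x := by
  have h := SK.sum_sq_le ((mem_cone.1 hx).mono hk)
  rw [← EuclideanSpace.real_norm_sq_eq] at h
  exact (abs_le_abs_of_nonneg (norm_nonneg x) (abs_le_of_sq_le_sq' h (hx 1 le_rfl (by omega)).le).2 |>.trans
    (abs_of_pos (hx 1 le_rfl (by omega))).le |> fun h => (le_abs_self _).trans h)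

theorem compactK {n k : ℕ} (hk : 2 ≤ k) {lam : EuclideanSpace ℝ (Fin n)}
    (hl : lam ∈ gardingCone n k) {c : ℝ} (hc : 0 < c) :
    IsCompact {μ ∈ gardingCone n k | c ≤ esymmFun n k μ ∧
      fderiv ℝ (esymmFun n k) lam (μ - lam) = 0} := by
  set L := fderiv ℝ (esymmFun n k) lam
  refine Metric.isCompact_of_isClosed_isBounded ?_ ?_
  · have : {μ ∈ gardingCone n k | c ≤ esymmFun n k μ ∧ L (μ - lam) = 0} =
        (⋂ j ∈ Finset.Icc 1 k, {μ | 0 ≤ esymmFun n j μ}) ∩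
        ((⋂ j ∈ Finset.Icc 1 k, {μ | esymmFun n j μ ≤ esymmFun n (j-1) μ * esymmFun n 1 μ}) ∩
        ({μ | c ≤ esymmFun n k μ} ∩ {μ | L (μ - lam) = 0})) := by
      ext μ
      simp only [Set.mem_setOf_eq, Set.mem_inter_iff, Set.mem_iInter, Finset.mem_Icc]
      constructor
      · rintro ⟨h1, h2, h3⟩
        refine ⟨fun j hj => (h1 j hj.1 hj.2).le, fun j hj => ?_, h2, h3⟩
        have := SK.E_le_mul (j-1) ((mem_cone.1 h1).mono (by omega))
        rwa [Nat.sub_add_cancel hj.1] at this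
      · rintro ⟨h0, h1, h2, h3⟩
        refine ⟨?_, h2, h3⟩
        have key : ∀ m, m < k → 0 < esymmFun n (k-m) μ := by
          intro m
          induction m with
          | zero => intro _; exact hc.trans_le h2
          | succ m ih =>
            intro hm
            have a := ih (by omega)
            have b := h1 (k-m) ⟨by omega, by omega⟩
            have d := h0 (k-m-1) ⟨by omega, by omega⟩
            rw [← Nat.sub_sub]
            refine d.lt_of_ne fun e => ?_
            rw [← e] at b
            linarith
        intro j h1j hjk
        have := key (k-j) (by omega)
        rwa [Nat.sub_sub_self hjk] at this
    rw [this]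
    refine (isClosed_biInter fun j _ => isClosed_le continuous_const (esymm_cont n j)).inter
      ((isClosed_biInter fun j _ => isClosed_le (esymm_cont n j)
        ((esymm_cont n _).mul (esymm_cont n 1))).inter
        ((isClosed_le continuous_const (esymm_cont n k)).inter
          (isClosed_eq (by fun_prop) continuous_const)))
  · rw [isBounded_iff_forall_norm_le]
    have hq : 0 < esymmFun n k lam / esymmFun n 1 lam :=
      div_pos (hl k (by omega) le_rfl) (hl 1 le_rfl (by omega))
    refine ⟨L lam / (esymmFun n k lam / esymmFun n 1 lam), ?_⟩
    rintro μ ⟨h1, _, h3⟩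
    have h4 := fderiv_lower (by omega) hl h1
    rw [map_sub, sub_eq_zero] at h3
    refine (norm_le_sigma hk h1).trans ?_
    rw [le_div_iff₀ hq, mul_comm, ← h3]
    exact h4

theorem exists_level {n k : ℕ} (hk : 2 ≤ k) (hkn : k ≤ n) {lam : EuclideanSpace ℝ (Fin n)}
    (hl : lam ∈ gardingCone n k) {c : ℝ} (hc : 0 < c) (hcl : c < esymmFun n k lam) :
    ∃ μ ∈ gardingCone n k, esymmFun n k μ = c ∧
      fderiv ℝ (esymmFun n k) lam (μ - lam) = 0 := by
  have hK := compactK hk hl hc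
  set L := fderiv ℝ (esymmFun n k) lam with hL
  obtain ⟨v, hv0, hv⟩ : ∃ v : EuclideanSpace ℝ (Fin n), v ≠ 0 ∧ L v = 0 := by
    let i0 : Fin n := ⟨0, by omega⟩
    let i1 : Fin n := ⟨1, by omega⟩
    have p1 := partial_pos (by omega) hl i1
    refine ⟨L (EuclideanSpace.single i1 1) • EuclideanSpace.single i0 1
      - L (EuclideanSpace.single i0 1) • EuclideanSpace.single i1 1, ?_, ?_⟩
    · intro h
      have := congrArg (fun w : EuclideanSpace ℝ (Fin n) => w i0) h
      have hne : i0 ≠ i1 := by simp [i0, i1]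
      simp [hne] at this
      exact p1.ne' this
    · simp only [map_sub, map_smul, smul_eq_mul]; ring
  let g : ℝ → EuclideanSpace ℝ (Fin n) := fun t => lam + t • v
  have hg : Continuous g := by fun_prop
  set K := {μ ∈ gardingCone n k | c ≤ esymmFun n k μ ∧ L (μ - lam) = 0} with hKdef
  have hLg : ∀ t, L (g t - lam) = 0 := by intro t; simp [g, hv]
  have hS : IsCompact (g ⁻¹' K) := by
    refine Metric.isCompact_of_isClosed_isBounded (hK.isClosed.preimage hg) ?_
    obtain ⟨C, hC⟩ := isBounded_iff_forall_norm_le.1 hK.isBounded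
    rw [isBounded_iff_forall_norm_le]
    have hvn : 0 < ‖v‖ := norm_pos_iff.2 hv0
    refine ⟨(C + ‖lam‖) / ‖v‖, fun t ht => ?_⟩
    rw [le_div_iff₀ hvn, ← norm_smul]
    have h1 := hC _ ht
    have : t • v = g t - lam := by simp [g]
    rw [this]
    exact (norm_sub_le _ _).trans (by linarith)
  have h0 : (0:ℝ) ∈ g ⁻¹' K := by
    refine ⟨?_, ?_, hLg 0⟩ <;> simp only [g, zero_smul, add_zero]
    · exact hl
    · exact hcl.le
  obtain ⟨t, ht, hmax⟩ := hS.exists_isGreatest ⟨0, h0⟩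
  refine ⟨g t, ht.1, ?_, hLg t⟩
  by_contra hne
  have hlt : c < esymmFun n k (g t) := lt_of_le_of_ne ht.2.1 (Ne.symm hne)
  have hopen : IsOpen (g ⁻¹' (gardingCone n k ∩ {μ | c < esymmFun n k μ})) :=
    ((cone_open n k).inter (isOpen_lt continuous_const (esymm_cont n k))).preimage hg
  have hmem := hopen.mem_nhds (show t ∈ _ from ⟨ht.1, hlt⟩)
  have hev : ∀ᶠ r in nhdsWithin t (Set.Ioi t),
      r ∈ g ⁻¹' (gardingCone n k ∩ {μ | c < esymmFun n k μ}) := mem_nhdsWithin_of_mem_nhds hmem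
  obtain ⟨r, hr, hr'⟩ := (hev.and self_mem_nhdsWithin).exists
  have : r ≤ t := hmax (show r ∈ g ⁻¹' K from ⟨hr.1, hr.2.le, hLg r⟩)
  exact absurd hr' (not_lt.2 this)

/-- for `2 ≤ k ≤ n`, `f = σ_k^{1/k}` on the Garding cone `Γ_k` is
homogeneous of degree one, has positive partial derivatives, is concave, and
satisfies the tangent-plane compactness condition. -/
theorem sigma_k_root_properties (n k : ℕ) (hk2 : 2 ≤ k) (hkn : k ≤ n) :
    (∀ (t : ℝ), 0 < t → ∀ x ∈ gardingCone n k,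
      sigmaRoot n k (t • x) = t * sigmaRoot n k x) ∧
    (∀ x ∈ gardingCone n k, ∀ i,
      0 < fderiv ℝ (sigmaRoot n k) x (EuclideanSpace.single i 1)) ∧
    ConcaveOn ℝ (gardingCone n k) (sigmaRoot n k) ∧
    (∀ σ' > (0 : ℝ), ∀ lam ∈ gardingCone n k, σ' < sigmaRoot n k lam →
      ({μ ∈ gardingCone n k | sigmaRoot n k μ = σ' ∧
          (∑ i, fderiv ℝ (sigmaRoot n k) lam (EuclideanSpace.single i 1) *
            (μ i - lam i)) = 0}).Nonempty ∧
      IsCompact {μ ∈ gardingCone n k | sigmaRoot n k μ = σ' ∧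
          (∑ i, fderiv ℝ (sigmaRoot n k) lam (EuclideanSpace.single i 1) *
            (μ i - lam i)) = 0}) := by
  have hk0 : (0:ℝ) < k := by exact_mod_cast (by omega : 0 < k)
  have hom : ∀ (t : ℝ), 0 < t → ∀ x ∈ gardingCone n k,
      sigmaRoot n k (t • x) = t * sigmaRoot n k x := by
    intro t ht x hx
    have hp : 0 < esymmFun n k x := hx k (by omega) le_rfl
    have : esymmFun n k (t • x) = t^k * esymmFun n k x := SK.E_smul _ _ _ _
    unfold sigmaRoot
    rw [this, Real.mul_rpow (by positivity) hp.le, one_div, Real.pow_rpow_inv_natCast ht.le (by omega)]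
  refine ⟨hom, ?_, ?_, ?_⟩
  · intro x hx i
    obtain ⟨a, ha, h⟩ := root_fderiv (by omega) hx
    rw [h]
    exact mul_pos ha (partial_pos (by omega) hx i)
  · have hadd : ∀ x ∈ gardingCone n k, ∀ y ∈ gardingCone n k, x + y ∈ gardingCone n k :=
      fun x hx y hy => mem_cone.2 (SK.G_add (mem_cone.1 hx) (mem_cone.1 hy))
    have hsm : ∀ x ∈ gardingCone n k, ∀ t : ℝ, 0 < t → t • x ∈ gardingCone n k :=
      fun x hx t ht => mem_cone.2 (SK.G_smul (mem_cone.1 hx) ht)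
    rw [concaveOn_iff_forall_pos]
    refine ⟨convex_iff_forall_pos.2 fun x hx y hy a b ha hb _ =>
      hadd _ (hsm x hx a ha) _ (hsm y hy b hb), ?_⟩
    intro x hx y hy a b ha hb _
    have := SK.root_superadd (by omega) (mem_cone.1 (hsm x hx a ha)) (mem_cone.1 (hsm y hy b hb))
    change sigmaRoot n k (a • x) + sigmaRoot n k (b • y) ≤ sigmaRoot n k (a • x + b • y) at this
    rw [hom a ha x hx, hom b hb y hy] at this
    exact this
  · intro σ' hσ lam hl hlt
    obtain ⟨a, ha, hfd⟩ := root_fderiv (by omega) hl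
    have hlin : ∀ μ : EuclideanSpace ℝ (Fin n),
        (∑ i, fderiv ℝ (sigmaRoot n k) lam (EuclideanSpace.single i 1) * (μ i - lam i)) = 0 ↔
        fderiv ℝ (esymmFun n k) lam (μ - lam) = 0 := by
      intro μ
      have h1 : fderiv ℝ (sigmaRoot n k) lam (μ - lam) =
          ∑ i, fderiv ℝ (sigmaRoot n k) lam (EuclideanSpace.single i 1) * (μ i - lam i) := by
        have h2 : μ - lam = ∑ i, (μ i - lam i) • EuclideanSpace.single i (1:ℝ) := by
          ext j
          simp [Finset.sum_apply, Pi.single_apply]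
        conv_lhs => rw [h2]
        rw [map_sum]
        refine Finset.sum_congr rfl fun i _ => ?_
        rw [map_smul, smul_eq_mul, mul_comm]
      rw [← h1, hfd]
      simp [ha.ne']
    have hroot : ∀ μ ∈ gardingCone n k, sigmaRoot n k μ = σ' ↔ esymmFun n k μ = σ' ^ k := by
      intro μ hμ
      have hp : 0 < esymmFun n k μ := hμ k (by omega) le_rfl
      unfold sigmaRoot
      rw [one_div]
      constructor
      · intro h
        rw [← h, Real.rpow_inv_natCast_pow hp.le (by omega)]
      · intro h
        rw [h, Real.pow_rpow_inv_natCast hσ.le (by omega)]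
    have hset : {μ ∈ gardingCone n k | sigmaRoot n k μ = σ' ∧
          (∑ i, fderiv ℝ (sigmaRoot n k) lam (EuclideanSpace.single i 1) *
            (μ i - lam i)) = 0} =
        {μ ∈ gardingCone n k | σ' ^ k ≤ esymmFun n k μ ∧
          fderiv ℝ (esymmFun n k) lam (μ - lam) = 0} ∩ {μ | esymmFun n k μ = σ' ^ k} := by
      ext μ
      constructor
      · rintro ⟨h1, h2, h3⟩
        have h4 := (hroot μ h1).1 h2
        exact ⟨⟨h1, h4.ge, (hlin μ).1 h3⟩, h4⟩
      · rintro ⟨⟨h1, _, h3⟩, h4⟩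
        exact ⟨h1, (hroot μ h1).2 h4, (hlin μ).2 h3⟩
    have hσk : 0 < σ' ^ k := by positivity
    have hclt : σ' ^ k < esymmFun n k lam := by
      have hp : 0 < esymmFun n k lam := hl k (by omega) le_rfl
      have h5 : sigmaRoot n k lam ^ k = esymmFun n k lam := by
        unfold sigmaRoot
        rw [one_div, Real.rpow_inv_natCast_pow hp.le (by omega)]
      rw [← h5]
      exact pow_lt_pow_left₀ hlt hσ.le (by omega)
    rw [hset]
    constructor
    · obtain ⟨μ, h1, h2, h3⟩ := exists_level hk2 hkn hl hσk hclt
      exact ⟨μ, ⟨h1, h2.ge, h3⟩, h2⟩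
    · exact (compactK hk2 hl hσk).inter_right (isClosed_eq (esymm_cont n k) continuous_const)
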